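/- Let S be a commutative semiring and A an n×n matrix over S. Then A·A^{adj+} and A·A^{adj−} satisfy: there exists an n×n matrix R over S such that A·A^{adj+} = |A|⁺·I + R and A·A^{adj−} = |A|⁻·I + R, where A^{adj+} has (i,j) entry |A(j,i)|⁺ if i+j is even and |A(j,i)|⁻ if i+j is odd, and A^{adj−} is defined with the parities exchanged. -/

import Mathlib

open scoped Classical

noncomputable section

/-- Positive part of the bideterminant: sum over even permutations. -/
def detp {S : Type*} [CommSemiring S] {n : ℕ} (A : Matrix (Fin n) (Fin n) S) : S :=
  ∑ σ ∈ Finset.univ.filter (fun σ : Equiv.Perm (Fin n) => Equiv.Perm.sign σ = 1),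
    ∏ i, A i (σ i)

/-- Negative part of the bideterminant: sum over odd permutations. -/
def detm {S : Type*} [CommSemiring S] {n : ℕ} (A : Matrix (Fin n) (Fin n) S) : S :=
  ∑ σ ∈ Finset.univ.filter (fun σ : Equiv.Perm (Fin n) => Equiv.Perm.sign σ = -1),
    ∏ i, A i (σ i)

/-- The positive adjoint matrix: its `(i,j)` entry is `|A(j,i)|⁺` if `i+j` is even
and `|A(j,i)|⁻` if `i+j` is odd, where `A(j,i)` is the submatrix deleting row `j`
and column `i`. -/
def adjP {S : Type*} [CommSemiring S] {n : ℕ} (A : Matrix (Fin (n+1)) (Fin (n+1)) S) :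
    Matrix (Fin (n+1)) (Fin (n+1)) S := fun i j =>
  if Even ((i : ℕ) + (j : ℕ)) then detp (A.submatrix j.succAbove i.succAbove)
  else detm (A.submatrix j.succAbove i.succAbove)

/-- The negative adjoint matrix: defined with the parities exchanged. -/
def adjM {S : Type*} [CommSemiring S] {n : ℕ} (A : Matrix (Fin (n+1)) (Fin (n+1)) S) :
    Matrix (Fin (n+1)) (Fin (n+1)) S := fun i j =>
  if Even ((i : ℕ) + (j : ℕ)) then detm (A.submatrix j.succAbove i.succAbove)
  else detp (A.submatrix j.succAbove i.succAbove)

open Equiv in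
/-- Extend a permutation of `Fin n` to one of `Fin (n+1)` sending `j` to `i`. -/
def extPerm {n : ℕ} (i j : Fin (n+1)) (τ : Equiv.Perm (Fin n)) : Equiv.Perm (Fin (n+1)) :=
  (Fin.cycleRange i)⁻¹ * Equiv.Perm.decomposeFin.symm (0, τ) * Fin.cycleRange j

lemma extPerm_self {n : ℕ} (i j : Fin (n+1)) (τ : Equiv.Perm (Fin n)) :
    extPerm i j τ j = i := by
  simp only [extPerm, Equiv.Perm.mul_apply, Fin.cycleRange_self,
    Equiv.Perm.decomposeFin_symm_apply_zero]
  exact Fin.cycleRange_symm_zero i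

lemma extPerm_succAbove {n : ℕ} (i j : Fin (n+1)) (τ : Equiv.Perm (Fin n)) (k : Fin n) :
    extPerm i j τ (j.succAbove k) = i.succAbove (τ k) := by
  simp only [extPerm, Equiv.Perm.mul_apply, Fin.cycleRange_succAbove,
    Equiv.Perm.decomposeFin_symm_apply_succ, Equiv.swap_self, Equiv.refl_apply]
  exact Fin.cycleRange_symm_succ i (τ k)

lemma sign_extPerm {n : ℕ} (i j : Fin (n+1)) (τ : Equiv.Perm (Fin n)) :
    Equiv.Perm.sign (extPerm i j τ) = (-1) ^ ((i : ℕ) + (j : ℕ)) * Equiv.Perm.sign τ := by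
  simp only [extPerm, map_mul, Equiv.Perm.sign_inv, Fin.sign_cycleRange,
    Equiv.Perm.decomposeFin.symm_sign, if_true, one_mul, pow_add]
  exact mul_right_comm _ _ _

lemma extPerm_injective {n : ℕ} (i j : Fin (n+1)) : Function.Injective (extPerm i j) := by
  intro τ τ' h
  ext k
  have := congrArg (fun σ => σ (j.succAbove k)) h
  simp only [extPerm_succAbove] at this
  rw [Fin.succAbove_right_injective this]

lemma extPerm_surj {n : ℕ} (i j : Fin (n+1)) (σ : Equiv.Perm (Fin (n+1))) (h : σ j = i) :
    ∃ τ, extPerm i j τ = σ := by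
  obtain ⟨⟨p, τ⟩, hp⟩ := Equiv.Perm.decomposeFin.symm.surjective
    (Fin.cycleRange i * σ * (Fin.cycleRange j)⁻¹)
  have h0 : p = 0 := by
    have := congrArg (fun σ => σ 0) hp
    simp only [Equiv.Perm.decomposeFin_symm_apply_zero, Equiv.Perm.mul_apply] at this
    rw [this]
    have h1 : (Fin.cycleRange j)⁻¹ 0 = j := Fin.cycleRange_symm_zero j
    rw [h1, h, Fin.cycleRange_self]
  subst h0
  refine ⟨τ, ?_⟩
  rw [extPerm, hp]
  group

lemma adjp_fin {S : Type*} [CommSemiring S] {n : ℕ} (A : Matrix (Fin (n+1)) (Fin (n+1)) S)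
    (s : ℤˣ) (i j : Fin (n+1)) :
    Matrix.adjp s A i j = Matrix.detp ((-1) ^ ((i : ℕ) + (j : ℕ)) * s)
      (A.submatrix j.succAbove i.succAbove) := by
  rw [Matrix.adjp_apply, Matrix.detp]
  symm
  refine Finset.sum_bij (fun τ _ => extPerm i j τ) ?_ ?_ ?_ ?_
  · intro τ hτ
    rw [Equiv.Perm.mem_ofSign] at hτ
    rw [Finset.mem_filter, Equiv.Perm.mem_ofSign, sign_extPerm, hτ, ← mul_assoc,
      Int.units_mul_self, one_mul]
    exact ⟨rfl, extPerm_self i j τ⟩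
  · intro τ _ τ' _ h
    exact extPerm_injective i j h
  · intro σ hσ
    rw [Finset.mem_filter, Equiv.Perm.mem_ofSign] at hσ
    obtain ⟨τ, rfl⟩ := extPerm_surj i j σ hσ.2
    refine ⟨τ, ?_, rfl⟩
    rw [Equiv.Perm.mem_ofSign, ← hσ.1, sign_extPerm, ← mul_assoc, Int.units_mul_self, one_mul]
  · intro τ _
    have : ({j}ᶜ : Finset (Fin (n+1))) = Finset.univ.map (Fin.succAboveEmb j) := by
      ext k
      simp [Fin.exists_succAbove_eq_iff]
    rw [this, Finset.prod_map]
    refine Finset.prod_congr rfl fun k _ => ?_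
    simp [extPerm_succAbove]

lemma detp_eq_one {S : Type*} [CommSemiring S] {n : ℕ} (A : Matrix (Fin n) (Fin n) S) :
    detp A = Matrix.detp 1 A := by
  unfold detp Matrix.detp Equiv.Perm.ofSign
  congr!

lemma detm_eq_neg {S : Type*} [CommSemiring S] {n : ℕ} (A : Matrix (Fin n) (Fin n) S) :
    detm A = Matrix.detp (-1) A := by
  unfold detm Matrix.detp Equiv.Perm.ofSign
  congr!

lemma adjP_eq {S : Type*} [CommSemiring S] {n : ℕ} (A : Matrix (Fin (n+1)) (Fin (n+1)) S) :
    adjP A = Matrix.adjp 1 A := by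
  ext i j
  rw [adjp_fin, adjP, detp_eq_one, detm_eq_neg]
  split_ifs with h
  · rw [h.neg_one_pow, one_mul]
  · rw [(Nat.not_even_iff_odd.mp h).neg_one_pow, mul_one]

lemma adjM_eq {S : Type*} [CommSemiring S] {n : ℕ} (A : Matrix (Fin (n+1)) (Fin (n+1)) S) :
    adjM A = Matrix.adjp (-1) A := by
  ext i j
  rw [adjp_fin, adjM, detp_eq_one, detm_eq_neg]
  split_ifs with h
  · rw [h.neg_one_pow, one_mul]
  · rw [(Nat.not_even_iff_odd.mp h).neg_one_pow, neg_mul_neg, one_mul]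

/-- Semiring Cramer identity: `A·A^{adj+} = |A|⁺·I + R` and `A·A^{adj−} = |A|⁻·I + R`
for some matrix `R`, over any commutative semiring. -/
theorem adjugate_identity_semiring {S : Type*} [CommSemiring S] {n : ℕ}
    (A : Matrix (Fin (n+1)) (Fin (n+1)) S) :
    ∃ R : Matrix (Fin (n+1)) (Fin (n+1)) S,
      A * adjP A = detp A • (1 : Matrix (Fin (n+1)) (Fin (n+1)) S) + R ∧
      A * adjM A = detm A • (1 : Matrix (Fin (n+1)) (Fin (n+1)) S) + R := by
  rw [adjP_eq, adjM_eq, detp_eq_one, detm_eq_neg]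
  refine ⟨Matrix.of fun i j => if i = j then 0 else (A * Matrix.adjp 1 A) i j, ?_, ?_⟩
  · ext i j
    by_cases h : i = j
    · subst h
      simp [Matrix.mul_adjp_apply_eq]
    · simp [h]
  · ext i j
    by_cases h : i = j
    · subst h
      simp [Matrix.mul_adjp_apply_eq]
    · simp [h, Matrix.mul_adjp_apply_ne A i j h]
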